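/- Let d ≥ 2, let W_local = ((d+1)/d³)·I − (1/d²)·V be the Werner state on ℂ^d ⊗ ℂ^d (I the d² × d² identity, V the flip operator), let P = |1⟩⟨1| + |2⟩⟨2| be the orthogonal projector onto the span of the first two standard basis vectors of ℂ^d, and let |S₁₂⟩ = (|12⟩ − |21⟩)/√2. Then (P ⊗ P) W_local (P ⊗ P) = (1/d³)·(P ⊗ P) + (2/d²)·|S₁₂⟩⟨S₁₂|, and its trace equals (2d + 4)/d³, so the normalized post-measurement state is W' = (d/(d+2))·((1/(2d))·(P ⊗ P) + |S₁₂⟩⟨S₁₂|). -/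

import Mathlib

open Matrix Kronecker

noncomputable section

/-- The flip operator on `ℂ^d ⊗ ℂ^d`, identified with `ℂ^(d²)` via the Kronecker
product: `V[(i,j),(k,l)] = 1` if `i = l` and `j = k`, and `0` otherwise. -/
def flipOp (d : ℕ) : Matrix (Fin d × Fin d) (Fin d × Fin d) ℂ :=
  Matrix.of fun p q => if p.1 = q.2 ∧ p.2 = q.1 then 1 else 0

/-- The Werner state `W_local = ((d+1)/d³)·I − (1/d²)·V`. -/
def wernerLocal (d : ℕ) : Matrix (Fin d × Fin d) (Fin d × Fin d) ℂ :=
  (((d : ℂ) + 1) / (d : ℂ) ^ 3) • (1 : Matrix (Fin d × Fin d) (Fin d × Fin d) ℂ) -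
    ((d : ℂ) ^ 2)⁻¹ • flipOp d

/-- The projector `P = |1⟩⟨1| + |2⟩⟨2|` onto the span of the first two standard
basis vectors of `ℂ^d`. -/
def projFirstTwo (d : ℕ) (hd : 2 ≤ d) : Matrix (Fin d) (Fin d) ℂ :=
  Matrix.of fun i j =>
    if i = j ∧ (i = (⟨0, by omega⟩ : Fin d) ∨ i = (⟨1, by omega⟩ : Fin d)) then 1 else 0

/-- The vector `|S₁₂⟩ = (|12⟩ − |21⟩)/√2` in `ℂ^d ⊗ ℂ^d`. -/
def s12Vec (d : ℕ) (hd : 2 ≤ d) : Fin d × Fin d → ℂ := fun p =>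
  if p = ((⟨0, by omega⟩ : Fin d), (⟨1, by omega⟩ : Fin d)) then ((Real.sqrt 2 : ℝ) : ℂ)⁻¹
  else if p = ((⟨1, by omega⟩ : Fin d), (⟨0, by omega⟩ : Fin d)) then -((Real.sqrt 2 : ℝ) : ℂ)⁻¹
  else 0

/-- The rank-one projector `|S₁₂⟩⟨S₁₂|`. -/
def s12Proj (d : ℕ) (hd : 2 ≤ d) : Matrix (Fin d × Fin d) (Fin d × Fin d) ℂ :=
  Matrix.of fun p q => s12Vec d hd p * (starRingEnd ℂ) (s12Vec d hd q)

/-- The singlet amplitude `1/√2` squares to `1/2`. -/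
theorem inv_sqrt_two_mul_self : ((Real.sqrt 2 : ℝ) : ℂ)⁻¹ * ((Real.sqrt 2 : ℝ) : ℂ)⁻¹ = 2⁻¹ := by
  rw [← mul_inv, ← Complex.ofReal_mul, Real.mul_self_sqrt (by norm_num)]
  norm_num

theorem projFirstTwo_eq_diagonal (d : ℕ) (hd : 2 ≤ d) :
    projFirstTwo d hd = Matrix.diagonal fun i : Fin d =>
      if i = (⟨0, by omega⟩ : Fin d) ∨ i = (⟨1, by omega⟩ : Fin d) then 1 else 0 := by
  ext i j
  simp only [projFirstTwo, Matrix.of_apply, Matrix.diagonal_apply, ite_and]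

theorem trace_projFirstTwo (d : ℕ) (hd : 2 ≤ d) : (projFirstTwo d hd).trace = 2 := by
  have h : (Finset.univ.filter fun i : Fin d =>
      i = (⟨0, by omega⟩ : Fin d) ∨ i = (⟨1, by omega⟩ : Fin d)) =
      {(⟨0, by omega⟩ : Fin d), (⟨1, by omega⟩ : Fin d)} := by
    ext i; simp
  rw [projFirstTwo_eq_diagonal, Matrix.trace_diagonal, Finset.sum_boole, h,
    Finset.card_pair (by simp)]
  norm_num

theorem projFirstTwo_mul_self (d : ℕ) (hd : 2 ≤ d) :
    projFirstTwo d hd * projFirstTwo d hd = projFirstTwo d hd := by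
  rw [projFirstTwo_eq_diagonal, Matrix.diagonal_mul_diagonal]
  congr 1
  ext i
  split_ifs <;> simp

theorem trace_s12Proj (d : ℕ) (hd : 2 ≤ d) : (s12Proj d hd).trace = 1 := by
  have hp (p : Fin d × Fin d) : s12Proj d hd p p =
      (if p = ((⟨0, by omega⟩ : Fin d), (⟨1, by omega⟩ : Fin d)) then 2⁻¹ else 0) +
      (if p = ((⟨1, by omega⟩ : Fin d), (⟨0, by omega⟩ : Fin d)) then 2⁻¹ else 0) := by
    simp only [s12Proj, s12Vec, Matrix.of_apply]
    split_ifs with h₁ h₂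
    · simp [h₁] at h₂
    all_goals simp [inv_sqrt_two_mul_self]
  simp only [Matrix.trace, Matrix.diag_apply, hp, Finset.sum_add_distrib, Finset.sum_ite_eq',
    Finset.mem_univ, if_true]
  norm_num

/-- On the two-qubit subspace the flip acts as the identity minus twice the singlet projector. -/
theorem filter_flipOp (d : ℕ) (hd : 2 ≤ d) :
    (projFirstTwo d hd ⊗ₖ projFirstTwo d hd) * flipOp d *
        (projFirstTwo d hd ⊗ₖ projFirstTwo d hd) =
      (projFirstTwo d hd ⊗ₖ projFirstTwo d hd) - (2 : ℂ) • s12Proj d hd := by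
  have hab : (⟨0, by omega⟩ : Fin d) ≠ ⟨1, by omega⟩ := by simp
  ext ⟨i, j⟩ ⟨k, l⟩
  simp only [projFirstTwo_eq_diagonal, Matrix.diagonal_kronecker_diagonal, Matrix.mul_diagonal,
    Matrix.diagonal_mul, Matrix.sub_apply, Matrix.smul_apply, Matrix.diagonal_apply, flipOp,
    s12Proj, s12Vec, Matrix.of_apply, Prod.mk.injEq, smul_eq_mul]
  generalize (⟨0, by omega⟩ : Fin d) = a at *
  generalize (⟨1, by omega⟩ : Fin d) = b at *
  have hba := hab.symm
  have hs := inv_sqrt_two_mul_self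
  have key (x : Fin d) : x = a ∨ x = b ∨ (x ≠ a ∧ x ≠ b) := by tauto
  rcases key i with rfl | rfl | ⟨hi, hi'⟩ <;> rcases key j with rfl | rfl | ⟨hj, hj'⟩ <;>
  rcases key k with rfl | rfl | ⟨hk, hk'⟩ <;> rcases key l with rfl | rfl | ⟨hl, hl'⟩ <;>
  simp_all <;> grind

/-- Local filtering of the Werner state `W_local` by `P ⊗ P`:
`(P⊗P) W_local (P⊗P) = (1/d³)·(P⊗P) + (2/d²)·|S₁₂⟩⟨S₁₂|`, whose trace is
`(2d+4)/d³`, and the normalized post-measurement state is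
`W' = (d/(d+2))·((1/(2d))·(P⊗P) + |S₁₂⟩⟨S₁₂|)`. -/
theorem werner_local_filtering (d : ℕ) (hd : 2 ≤ d) :
    (projFirstTwo d hd ⊗ₖ projFirstTwo d hd) * wernerLocal d *
        (projFirstTwo d hd ⊗ₖ projFirstTwo d hd) =
      ((d : ℂ) ^ 3)⁻¹ • (projFirstTwo d hd ⊗ₖ projFirstTwo d hd) +
        (2 / (d : ℂ) ^ 2) • s12Proj d hd ∧
    Matrix.trace ((projFirstTwo d hd ⊗ₖ projFirstTwo d hd) * wernerLocal d *
        (projFirstTwo d hd ⊗ₖ projFirstTwo d hd)) = (2 * (d : ℂ) + 4) / (d : ℂ) ^ 3 ∧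
    ((2 * (d : ℂ) + 4) / (d : ℂ) ^ 3)⁻¹ •
        ((projFirstTwo d hd ⊗ₖ projFirstTwo d hd) * wernerLocal d *
          (projFirstTwo d hd ⊗ₖ projFirstTwo d hd)) =
      ((d : ℂ) / ((d : ℂ) + 2)) •
        ((2 * (d : ℂ))⁻¹ • (projFirstTwo d hd ⊗ₖ projFirstTwo d hd) + s12Proj d hd) := by
  have hd0 : (d : ℂ) ≠ 0 := Nat.cast_ne_zero.mpr (by omega)
  have hd2 : (d : ℂ) + 2 ≠ 0 := by exact_mod_cast (by omega : d + 2 ≠ 0)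
  have hd4 : 2 * (d : ℂ) + 4 ≠ 0 := by exact_mod_cast (by omega : 2 * d + 4 ≠ 0)
  have main : (projFirstTwo d hd ⊗ₖ projFirstTwo d hd) * wernerLocal d *
        (projFirstTwo d hd ⊗ₖ projFirstTwo d hd) =
      ((d : ℂ) ^ 3)⁻¹ • (projFirstTwo d hd ⊗ₖ projFirstTwo d hd) +
        (2 / (d : ℂ) ^ 2) • s12Proj d hd := by
    rw [wernerLocal, mul_sub, sub_mul, mul_smul_comm, mul_smul_comm, smul_mul_assoc,
      smul_mul_assoc, filter_flipOp, mul_one, ← Matrix.mul_kronecker_mul, projFirstTwo_mul_self]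
    match_scalars <;> field_simp
    ring
  refine ⟨main, ?_, ?_⟩
  · rw [main, Matrix.trace_add, Matrix.trace_smul, Matrix.trace_smul, Matrix.trace_kronecker,
      trace_projFirstTwo, trace_s12Proj, smul_eq_mul, smul_eq_mul]
    field_simp
    ring
  · rw [main]
    match_scalars <;> field_simp <;> ring

end
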